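/- arXiv:2302.04402 — 7 statements merged into one kernel-verified Lean document; each statement's English description precedes it below -/
import Mathlib

section
/- Let B be a non-degenerate Boolean algebra. Each B-set structure on a set X induces the family of relations (≡_b : b ∈ B), each an equivalence relation, satisfying: (i) if x ≡_b y and c ≤ b then x ≡_c y; (ii) x ≡_1 y iff x = y, and x ≡_0 y always; (iii) if x ≡_b y and x ≡_c y then x ≡_{b ⊔ c} y; (iv) for any x, y ∈ X and b ∈ B there exists z ∈ X with z ≡_b x and z ≡_{bᶜ} y. Conversely, any family of equivalence relations (≡_b : b ∈ B) on X satisfying (i)–(iv) arises from a unique B-set structure on X, whose operation is characterised by: b(x,y) is the unique element with b(x,y) ≡_b x and b(x,y) ≡_{bᶜ} y. Moreover, under this correspondence a function X → Y between B-sets is a B-set homomorphism if and only if it preserves each relation ≡_b. -/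
/-- A `B`-set structure on `X`, for a Boolean algebra `B`. -/
structure BSetStruct (B : Type) [BooleanAlgebra B] (X : Type) where
  act : B → X → X → X
  act_refl : ∀ b x, act b x x = x
  act_absorb_left : ∀ b x y z, act b (act b x y) z = act b x z
  act_absorb_right : ∀ b x y z, act b x (act b y z) = act b x z
  act_top : ∀ x y, act ⊤ x y = x
  act_compl : ∀ b x y, act bᶜ x y = act b y x
  act_inf : ∀ b c x y, act (b ⊓ c) x y = act b (act c x y) y

/-- The relation `x ≡_b y`, i.e. `b(x,y) = y`. -/
def BSetStruct.eqv {B X : Type} [BooleanAlgebra B] (S : BSetStruct B X)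
    (b : B) (x y : X) : Prop :=
  S.act b x y = y

/-- A homomorphism of `B`-sets. -/
def IsBSetHom {B X Y : Type} [BooleanAlgebra B]
    (SX : BSetStruct B X) (SY : BSetStruct B Y) (f : X → Y) : Prop :=
  ∀ b x y, f (SX.act b x y) = SY.act b (f x) (f y)

namespace BSetStruct

section Induced

variable {B X : Type} [BooleanAlgebra B] (S : BSetStruct B X)

theorem eqv_equivalence (b : B) : Equivalence (S.eqv b) where
  refl := S.act_refl b
  symm {x y} h := by
    unfold eqv at *
    rw [← h, S.act_absorb_left, S.act_refl]
  trans {x y z} hxy hyz := by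
    unfold eqv at *
    rw [← S.act_absorb_left b x y z, hxy, hyz]

variable {S}

theorem eqv.mono {b c : B} {x y : X} (h : S.eqv b x y) (hcb : c ≤ b) : S.eqv c x y := by
  unfold eqv at *
  rw [← inf_eq_left.mpr hcb, S.act_inf, h, S.act_refl]

theorem eqv.sup {b c : B} {x y : X} (hb : S.eqv b x y) (hc : S.eqv c x y) :
    S.eqv (b ⊔ c) x y := by
  unfold eqv at *
  rw [← compl_compl (b ⊔ c), compl_sup, S.act_compl, S.act_inf, S.act_compl, S.act_compl, hc, hb]

variable (S)

theorem eqv_top_iff (x y : X) : S.eqv ⊤ x y ↔ x = y := by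
  rw [eqv, S.act_top]

theorem eqv_bot (x y : X) : S.eqv ⊥ x y := by
  rw [eqv, ← compl_top, S.act_compl, S.act_top]

theorem act_eqv_left (b : B) (x y : X) : S.eqv b (S.act b x y) x := by
  rw [eqv, S.act_absorb_left, S.act_refl]

theorem act_eqv_right (b : B) (x y : X) : S.eqv bᶜ (S.act b x y) y := by
  rw [eqv, S.act_compl, S.act_absorb_right, S.act_refl]

variable {S}

theorem eq_act {b : B} {x y z : X} (hx : S.eqv b z x) (hy : S.eqv bᶜ z y) :
    z = S.act b x y := by
  have hy' : S.act bᶜ y z = z := (S.eqv_equivalence _).symm hy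
  have hx' : S.act b z x = x := hx
  rw [S.act_compl] at hy'
  rw [← hx', S.act_absorb_left, hy']

theorem ext_eqv {T : BSetStruct B X} (h : ∀ b x y, S.eqv b x y → T.eqv b x y) : S = T := by
  have key : S.act = T.act := by
    funext b x y
    exact eq_act (h _ _ _ (S.act_eqv_left b x y)) (h _ _ _ (S.act_eqv_right b x y))
  cases S
  cases T
  cases key
  rfl

end Induced

section OfRelations

variable {B X : Type} [BooleanAlgebra B] {E : B → X → X → Prop}

theorem eq_of_rel_of_rel_compl (hEtop : ∀ x y, E ⊤ x y → x = y)
    (hEsup : ∀ b c x y, E b x y → E c x y → E (b ⊔ c) x y) {b : B} {x y : X}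
    (h : E b x y) (h' : E bᶜ x y) : x = y :=
  hEtop x y (sup_compl_eq_top (x := b) ▸ hEsup _ _ _ _ h h')

/-- The operation picks the element `≡_b`-related to the first argument
and `≡_{bᶜ}`-related to the second. -/
theorem exists_of_rel (hE : ∀ b, Equivalence (E b))
    (hEmono : ∀ b c x y, E b x y → c ≤ b → E c x y)
    (hEtop : ∀ x y, E ⊤ x y → x = y)
    (hEsup : ∀ b c x y, E b x y → E c x y → E (b ⊔ c) x y)
    (hEglue : ∀ x y b, ∃ z, E b z x ∧ E bᶜ z y) :
    ∃ S : BSetStruct B X, ∀ b x y, E b x y ↔ S.eqv b x y := by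
  choose g hl hr using hEglue
  have uniq {b x y w} (hx : E b w x) (hy : E bᶜ w y) : g x y b = w :=
    eq_of_rel_of_rel_compl hEtop hEsup ((hE _).trans (hl x y b) ((hE _).symm hx))
      ((hE _).trans (hr x y b) ((hE _).symm hy))
  refine ⟨{ act := fun b x y => g x y b
            act_refl := fun b x => uniq ((hE _).refl x) ((hE _).refl x)
            act_absorb_left := fun b x y z =>
              uniq ((hE _).trans (hl _ _ _) ((hE _).symm (hl _ _ _))) (hr _ _ _)
            act_absorb_right := fun b x y z =>
              uniq (hl _ _ _) ((hE _).trans (hr _ _ _) ((hE _).symm (hr _ _ _)))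
            act_top := fun x y => hEtop _ _ (hl _ _ _)
            act_compl := fun b x y =>
              uniq (hr _ _ _) (by rw [compl_compl]; exact hl _ _ _)
            act_inf := fun b c x y => ?_ }, fun b x y => ?_⟩
  · refine uniq ((hE _).trans (hEmono _ _ _ _ (hl _ _ b) inf_le_left)
      (hEmono _ _ _ _ (hl _ _ c) inf_le_right)) ?_
    rw [compl_inf]
    refine hEsup _ _ _ _ (hr _ _ _) ?_
    have h₁ : E (b ⊓ cᶜ) (g (g x y c) y b) y :=
      (hE _).trans (hEmono _ _ _ _ (hl _ _ b) inf_le_left)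
        (hEmono _ _ _ _ (hr _ _ c) inf_le_right)
    have h₂ : E bᶜ (g (g x y c) y b) y := hr _ _ _
    refine hEmono _ _ _ _ (hEsup _ _ _ _ h₁ h₂) ?_
    rw [sup_inf_right, sup_compl_eq_top, top_inf_eq]
    exact le_sup_left
  · exact ⟨fun h => uniq ((hE _).symm h) ((hE _).refl y), fun h => by
      have h : g x y b = y := h
      have hx := hl x y b
      rw [h] at hx
      exact (hE _).symm hx⟩

end OfRelations

end BSetStruct

theorem isBSetHom_iff {B X Y : Type} [BooleanAlgebra B] (SX : BSetStruct B X)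
    (SY : BSetStruct B Y) (f : X → Y) :
    IsBSetHom SX SY f ↔ ∀ b x y, SX.eqv b x y → SY.eqv b (f x) (f y) := by
  refine ⟨fun hf b x y h => ?_, fun hf b x y => ?_⟩
  · rw [BSetStruct.eqv, ← hf, show SX.act b x y = y from h]
  · exact BSetStruct.eq_act (hf _ _ _ (SX.act_eqv_left b x y)) (hf _ _ _ (SX.act_eqv_right b x y))

/-- Correspondence between `B`-set structures on `X` and families of
equivalence relations `(≡_b : b ∈ B)` satisfying conditions (i)–(iv); under it,
a function between `B`-sets is a homomorphism iff it preserves each `≡_b`. -/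
theorem bset_equivalence_relations_correspondence
    (B X Y : Type) [BooleanAlgebra B] (nondeg : (⊥ : B) ≠ ⊤) :
    -- each `B`-set structure induces equivalence relations satisfying (i)–(iv)
    (∀ S : BSetStruct B X,
      (∀ b : B, Equivalence (S.eqv b)) ∧
      (∀ (b c : B) (x y : X), S.eqv b x y → c ≤ b → S.eqv c x y) ∧
      (∀ x y : X, (S.eqv ⊤ x y ↔ x = y) ∧ S.eqv ⊥ x y) ∧
      (∀ (b c : B) (x y : X), S.eqv b x y → S.eqv c x y → S.eqv (b ⊔ c) x y) ∧
      (∀ (x y : X) (b : B), ∃ z : X, S.eqv b z x ∧ S.eqv bᶜ z y)) ∧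
    -- conversely, any such family arises from a unique `B`-set structure,
    -- whose operation is characterised by (iv)
    (∀ E : B → X → X → Prop,
      (∀ b : B, Equivalence (E b)) →
      (∀ (b c : B) (x y : X), E b x y → c ≤ b → E c x y) →
      (∀ x y : X, (E ⊤ x y ↔ x = y) ∧ E ⊥ x y) →
      (∀ (b c : B) (x y : X), E b x y → E c x y → E (b ⊔ c) x y) →
      (∀ (x y : X) (b : B), ∃ z : X, E b z x ∧ E bᶜ z y) →
      (∃! S : BSetStruct B X, ∀ (b : B) (x y : X), E b x y ↔ S.eqv b x y) ∧
      (∀ S : BSetStruct B X, (∀ (b : B) (x y : X), E b x y ↔ S.eqv b x y) →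
        ∀ (b : B) (x y : X),
          E b (S.act b x y) x ∧ E bᶜ (S.act b x y) y ∧
          ∀ z : X, E b z x → E bᶜ z y → z = S.act b x y)) ∧
    -- homomorphisms are exactly the maps preserving each `≡_b`
    (∀ (SX : BSetStruct B X) (SY : BSetStruct B Y) (f : X → Y),
      IsBSetHom SX SY f ↔
        ∀ (b : B) (x y : X), SX.eqv b x y → SY.eqv b (f x) (f y)) := by
  refine ⟨fun S => ⟨S.eqv_equivalence, fun _ _ _ _ h hcb => h.mono hcb,
    fun x y => ⟨S.eqv_top_iff x y, S.eqv_bot x y⟩, fun _ _ _ _ hb hc => hb.sup hc,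
    fun x y b => ⟨S.act b x y, S.act_eqv_left b x y, S.act_eqv_right b x y⟩⟩, ?_, isBSetHom_iff⟩
  intro E hE hEmono hEtop hEsup hEglue
  refine ⟨?_, fun S hS b x y => ?_⟩
  · obtain ⟨S, hS⟩ := BSetStruct.exists_of_rel hE hEmono (fun x y => (hEtop x y).1.1) hEsup hEglue
    exact ⟨S, hS, fun T hT => BSetStruct.ext_eqv fun b x y h => (hS b x y).1 ((hT b x y).2 h)⟩
  · simp only [hS]
    exact ⟨S.act_eqv_left b x y, S.act_eqv_right b x y, fun _ => BSetStruct.eq_act⟩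
end

section
/- Let B be a non-degenerate Boolean algebra and P a partition of B. Then: (i) if X is a B-set and P, P' : X^P → X are two operations each satisfying the three axioms P(λb.x) = x, P(λb. b(x_b, y_b)) = P(λb. x_b), and b(P(x), x_b) = x_b for all b ∈ P, then P = P'; and (ii) if X and Y are B-sets each admitting an operation P satisfying these axioms, then any B-set homomorphism f : X → Y preserves it: f(P(x)) = P(λb. f(x_b)) for all x ∈ X^P. -/
/-- `P` is a partition of `b`: a set of nonzero pairwise-disjoint elements
whose supremum exists and equals `b`. -/
def IsPartitionOf {B : Type} [BooleanAlgebra B] (P : Set B) (b : B) : Prop :=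
  (∀ c ∈ P, c ≠ ⊥) ∧ (∀ c ∈ P, ∀ d ∈ P, c ≠ d → c ⊓ d = ⊥) ∧ IsLUB P b

/-- The three axioms for a partition operation `PO : X^P → X` on a `B`-set. -/
def IsPartitionOp {B X : Type} [BooleanAlgebra B] (P : Set B)
    (S : BSetStruct B X) (PO : (P → X) → X) : Prop :=
  (∀ x : X, PO (fun _ => x) = x) ∧
  (∀ x y : P → X, PO (fun b => S.act b.1 (x b) (y b)) = PO x) ∧
  (∀ (x : P → X) (b : P), S.act b.1 (PO x) (x b) = x b)

/-- A partition operation sends a family to any element that agrees with it on every part. -/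
theorem IsPartitionOp.eq_of_agree {B X : Type} [BooleanAlgebra B] {P : Set B}
    {S : BSetStruct B X} {PO : (P → X) → X} (h : IsPartitionOp P S PO)
    {x : P → X} {z : X} (hz : ∀ b : P, S.act b.1 z (x b) = x b) : z = PO x := by
  have key := h.2.1 (fun _ => z) x
  simp only [hz, h.1] at key
  exact key.symm

/-- (i) A partition operation on a `B`-set is unique if it exists; and
(ii) any `B`-set homomorphism between `B`-sets admitting the operation
preserves it. -/
theorem partition_op_unique_and_preserved (B X Y : Type) [BooleanAlgebra B]
    (nondeg : (⊥ : B) ≠ ⊤) (P : Set B) (hP : IsPartitionOf P ⊤)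
    (SX : BSetStruct B X) (SY : BSetStruct B Y) :
    (∀ PO PO' : (P → X) → X,
      IsPartitionOp P SX PO → IsPartitionOp P SX PO' → PO = PO') ∧
    (∀ (PO : (P → X) → X) (PO' : (P → Y) → Y),
      IsPartitionOp P SX PO → IsPartitionOp P SY PO' →
      ∀ f : X → Y, IsBSetHom SX SY f →
        ∀ x : P → X, f (PO x) = PO' (fun b => f (x b))) := by
  refine ⟨fun PO PO' h h' => funext fun x => h'.eq_of_agree (h.2.2 x),
    fun PO PO' h h' f hf x => h'.eq_of_agree fun b => ?_⟩
  rw [← hf, h.2.2]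
end

section
/- Let B_𝒥 be a non-degenerate Grothendieck Boolean algebra. A B-set X admits a B_𝒥-set structure if, and only if, for each infinite P ∈ 𝒥 and each family x ∈ X^P there is a unique element z ∈ X with z ≡_b x_b for all b ∈ P (in which case the operation is P(x) = z). -/
/-- A zero-dimensional topology on a Boolean algebra `B`: a collection `J` of
partitions of `1` containing all finite partitions, closed under refinement and
under images along surjections. -/
structure ZeroDimTopology (B : Type) [BooleanAlgebra B] where
  J : Set (Set B)
  partitions : ∀ P ∈ J, IsPartitionOf P ⊤
  finite_mem : ∀ P : Set B, IsPartitionOf P ⊤ → P.Finite → P ∈ J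
  refine : ∀ P ∈ J, ∀ Q : B → Set B, (∀ b ∈ P, Q b ∈ J) →
      ({d : B | ∃ b ∈ P, ∃ c ∈ Q b, d = b ⊓ c} \ {⊥}) ∈ J
  glue : ∀ (P : Set B), P ∈ J → ∀ (I : Type) (α : P → I), Function.Surjective α →
      (∀ i : I, ∃ s : B, IsLUB (Subtype.val '' (α ⁻¹' {i})) s) ∧
      {s : B | ∃ i : I, IsLUB (Subtype.val '' (α ⁻¹' {i})) s} ∈ J

/-- A `B_𝒥`-set: a `B`-set together with an operation `X^P → X` for each
infinite partition `P ∈ 𝒥`, satisfying the three axioms. -/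
structure BJSetStruct (B : Type) [BooleanAlgebra B] (𝒥 : ZeroDimTopology B)
    (X : Type) extends BSetStruct B X where
  pop : ∀ (P : Set B), P ∈ 𝒥.J → P.Infinite → (P → X) → X
  pop_const : ∀ (P : Set B) (hP : P ∈ 𝒥.J) (hinf : P.Infinite) (x : X),
      pop P hP hinf (fun _ => x) = x
  pop_act : ∀ (P : Set B) (hP : P ∈ 𝒥.J) (hinf : P.Infinite) (x y : P → X),
      pop P hP hinf (fun b => act b.1 (x b) (y b)) = pop P hP hinf x
  act_pop : ∀ (P : Set B) (hP : P ∈ 𝒥.J) (hinf : P.Infinite) (x : P → X) (b : P),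
      act b.1 (pop P hP hinf x) (x b) = x b

/-- If `z ≡_b x`, then `z ≡_b b(x,y)` for every `y`. -/
theorem BSetStruct.eqv.act_right {B X : Type} [BooleanAlgebra B] {S : BSetStruct B X}
    {b : B} {z x : X} (h : S.eqv b z x) (y : X) : S.eqv b z (S.act b x y) := by
  have h' := S.act_absorb_left b z x y
  rw [show S.act b z x = x from h] at h'
  exact (S.act_absorb_right b z x y).trans h'.symm

/-- The operation `P` of a `B_𝒥`-set sends a family `x` to any element that agrees with
each `x b` on `b`. -/
theorem BJSetStruct.pop_eq_of_eqv {B X : Type} [BooleanAlgebra B] {𝒥 : ZeroDimTopology B}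
    (T : BJSetStruct B 𝒥 X) {P : Set B} (hP : P ∈ 𝒥.J) (hinf : P.Infinite) {x : P → X} {z : X}
    (h : ∀ b : P, T.eqv b.1 z (x b)) : T.pop P hP hinf x = z := by
  have h' := T.pop_act P hP hinf (fun _ => z) x
  rwa [T.pop_const, show (fun b : P => T.act b.1 z (x b)) = x from funext h] at h'

/-- The `B_𝒥`-set structure on a `B`-set in which families indexed by infinite partitions
in `𝒥` have unique gluings. -/
noncomputable def BSetStruct.toBJSetStruct {B X : Type} [BooleanAlgebra B]
    {𝒥 : ZeroDimTopology B} (S : BSetStruct B X)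
    (h : ∀ (P : Set B), P ∈ 𝒥.J → P.Infinite → ∀ x : P → X,
      ∃! z : X, ∀ b : P, S.eqv b.1 z (x b)) : BJSetStruct B 𝒥 X where
  toBSetStruct := S
  pop P hP hinf x := (h P hP hinf x).choose
  pop_const P hP hinf x :=
    ((h P hP hinf fun _ => x).choose_spec.2 x fun b => S.act_refl b.1 x).symm
  pop_act P hP hinf x y :=
    ((h P hP hinf fun b => S.act b.1 (x b) (y b)).choose_spec.2 _ fun b =>
      ((h P hP hinf x).choose_spec.1 b).act_right (y b)).symm
  act_pop P hP hinf x b := (h P hP hinf x).choose_spec.1 b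

/-- A `B`-set `X` admits a `B_𝒥`-set structure iff for every infinite `P ∈ 𝒥`
and `x ∈ X^P` there is a unique `z` with `z ≡_b x_b` for all `b ∈ P`; in which
case the operation is given by `P(x) = z`. -/
theorem bset_is_bjset_iff (B X : Type) [BooleanAlgebra B]
    (nondeg : (⊥ : B) ≠ ⊤) (𝒥 : ZeroDimTopology B) (S : BSetStruct B X) :
    ((∃ T : BJSetStruct B 𝒥 X, T.toBSetStruct = S) ↔
      (∀ (P : Set B), P ∈ 𝒥.J → P.Infinite → ∀ x : P → X,
        ∃! z : X, ∀ b : P, S.eqv b.1 z (x b))) ∧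
    (∀ T : BJSetStruct B 𝒥 X, T.toBSetStruct = S →
      ∀ (P : Set B) (hP : P ∈ 𝒥.J) (hinf : P.Infinite) (x : P → X) (b : P),
        S.eqv b.1 (T.pop P hP hinf x) (x b)) := by
  refine ⟨⟨?_, fun h => ⟨S.toBJSetStruct h, rfl⟩⟩, ?_⟩
  · rintro ⟨T, rfl⟩ P hP hinf x
    exact ⟨T.pop P hP hinf x, T.act_pop P hP hinf x, fun z hz => (T.pop_eq_of_eqv hP hinf hz).symm⟩
  · rintro T rfl P hP hinf x b
    exact T.act_pop P hP hinf x b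
end

section
/- Let 𝕋 be a non-degenerate hyperaffine algebraic theory. Then T(2) underlies a non-degenerate Boolean algebra in which 1 = π_1, 0 = π_2, and meet, join, and complement are given by substitution: b ⊓ c = b(c(π_1,π_2), π_2), b ⊔ c = b(π_1, c(π_1,π_2)), and bᶜ = b(π_2, π_1), for b, c ∈ T(2). -/
/-- An (infinitary) algebraic theory. -/
structure AlgTheory where
  T : Type → Type
  pr : ∀ {I : Type}, I → T I
  subst : ∀ {I J : Type}, T I → (I → T J) → T J
  subst_pr : ∀ {I : Type} (t : T I), subst t (fun i => pr i) = t
  pr_subst : ∀ {I J : Type} (i : I) (u : I → T J), subst (pr i) u = u i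
  subst_assoc : ∀ {I J K : Type} (t : T I) (u : I → T J) (v : J → T K),
      subst (subst t u) v = subst t (fun i => subst (u i) v)

def AlgTheory.IsAffine (𝕋 : AlgTheory) {I : Type} (t : 𝕋.T I) : Prop :=
  𝕋.subst t (fun _ => 𝕋.pr PUnit.unit) = 𝕋.pr PUnit.unit

def AlgTheory.IsHyperaffine (𝕋 : AlgTheory) {I : Type} (t : 𝕋.T I) : Prop :=
  𝕋.IsAffine t ∧
  𝕋.subst t (fun i => 𝕋.subst t (fun j => 𝕋.pr (i, j))) =
    𝕋.subst t (fun i => 𝕋.pr (i, i))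

/-- We model the two-element arity `2 = {1, 2}` by `Bool`, with `π₁ = pr true`
and `π₂ = pr false`.  For `b, c, d ∈ T 2`, `𝕋.sub2 b c d` is the substitution
`b(c, d)` of the pair `(c, d)` into `b`. -/
def AlgTheory.sub2 (𝕋 : AlgTheory) (b c d : 𝕋.T Bool) : 𝕋.T Bool :=
  𝕋.subst b (fun i => if i then c else d)

namespace AlgTheory

variable (𝕋 : AlgTheory)

theorem sub2_sub2 (b c d x y : 𝕋.T Bool) :
    𝕋.sub2 (𝕋.sub2 b c d) x y = 𝕋.sub2 b (𝕋.sub2 c x y) (𝕋.sub2 d x y) := by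
  unfold sub2
  rw [subst_assoc]
  congr 1
  funext i
  cases i <;> rfl

theorem sub2_pr_true (x y : 𝕋.T Bool) : 𝕋.sub2 (𝕋.pr true) x y = x :=
  𝕋.pr_subst _ _

theorem sub2_pr_false (x y : 𝕋.T Bool) : 𝕋.sub2 (𝕋.pr false) x y = y :=
  𝕋.pr_subst _ _

theorem sub2_pr_pr (b : 𝕋.T Bool) : 𝕋.sub2 b (𝕋.pr true) (𝕋.pr false) = b := by
  conv_rhs => rw [← 𝕋.subst_pr b]
  unfold sub2
  congr 1
  funext i
  cases i <;> rfl

variable {𝕋}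

theorem IsAffine.subst_const {I J : Type} {t : 𝕋.T I} (ht : 𝕋.IsAffine t) (x : 𝕋.T J) :
    𝕋.subst t (fun _ => x) = x := by
  have h := congrArg (fun s => 𝕋.subst s (fun _ => x)) ht
  simpa only [subst_assoc, pr_subst] using h

theorem IsAffine.sub2_self {b : 𝕋.T Bool} (hb : 𝕋.IsAffine b) (x : 𝕋.T Bool) :
    𝕋.sub2 b x x = x := by
  simpa [sub2] using hb.subst_const x

theorem IsHyperaffine.subst_diag {I J : Type} {t : 𝕋.T I} (ht : 𝕋.IsHyperaffine t)
    (x : I → I → 𝕋.T J) :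
    𝕋.subst t (fun i => 𝕋.subst t (x i)) = 𝕋.subst t (fun i => x i i) := by
  have h := congrArg (fun s => 𝕋.subst s (fun p => x p.1 p.2)) ht.2
  simpa only [subst_assoc, pr_subst] using h

theorem IsHyperaffine.sub2_diag {b : 𝕋.T Bool} (hb : 𝕋.IsHyperaffine b) (x y z w : 𝕋.T Bool) :
    𝕋.sub2 b (𝕋.sub2 b x y) (𝕋.sub2 b z w) = 𝕋.sub2 b x w := by
  have h := hb.subst_diag (fun i j => if i then (if j then x else y) else (if j then z else w))
  unfold sub2
  convert h using 2 <;> funext i <;> cases i <;> rfl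

theorem IsHyperaffine.sub2_left {b : 𝕋.T Bool} (hb : 𝕋.IsHyperaffine b) (x y z : 𝕋.T Bool) :
    𝕋.sub2 b (𝕋.sub2 b x y) z = 𝕋.sub2 b x z := by
  simpa only [hb.1.sub2_self] using hb.sub2_diag x y z z

theorem IsHyperaffine.sub2_right {b : 𝕋.T Bool} (hb : 𝕋.IsHyperaffine b) (x y z : 𝕋.T Bool) :
    𝕋.sub2 b x (𝕋.sub2 b y z) = 𝕋.sub2 b x z := by
  simpa only [hb.1.sub2_self] using hb.sub2_diag x x y z

/-- In a hyperaffine theory, any two binary operations commute: this is hyperaffineness of the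
four-variable operation `b(c(-, -), c(-, -))`, evaluated at a suitable matrix. -/
theorem sub2_comm (hyp : ∀ (I : Type) (t : 𝕋.T I), 𝕋.IsHyperaffine t)
    (b c x y z w : 𝕋.T Bool) :
    𝕋.sub2 c (𝕋.sub2 b x z) (𝕋.sub2 b y w) = 𝕋.sub2 b (𝕋.sub2 c x y) (𝕋.sub2 c z w) := by
  let t : 𝕋.T (Bool × Bool) := 𝕋.subst b fun i => 𝕋.subst c fun j => 𝕋.pr (i, j)
  have ht (v : Bool × Bool → 𝕋.T Bool) : 𝕋.subst t v =
      𝕋.sub2 b (𝕋.sub2 c (v (true, true)) (v (true, false)))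
        (𝕋.sub2 c (v (false, true)) (v (false, false))) := by
    simp only [t, subst_assoc, pr_subst, sub2]
    congr 1
    funext i
    cases i <;> simp only [Bool.false_eq_true, if_true, if_false] <;> congr 1 <;> funext j <;>
      cases j <;> rfl
  have h := (hyp _ t).subst_diag (J := Bool) fun i j =>
    if j.1 then (if i.2 then x else y) else (if i.2 then z else w)
  simpa [ht, (hyp _ _).1.sub2_self] using h

/-- The Boolean algebra of binary operations of a hyperaffine theory. -/
abbrev booleanAlgebra (hyp : ∀ (I : Type) (t : 𝕋.T I), 𝕋.IsHyperaffine t) :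
    BooleanAlgebra (𝕋.T Bool) :=
  have idem (b x : 𝕋.T Bool) : 𝕋.sub2 b x x = x := (hyp _ b).1.sub2_self x
  letI : Max (𝕋.T Bool) := ⟨fun b c => 𝕋.sub2 b (𝕋.pr true) c⟩
  letI : Min (𝕋.T Bool) := ⟨fun b c => 𝕋.sub2 b c (𝕋.pr false)⟩
  have sup_def (b c : 𝕋.T Bool) : b ⊔ c = 𝕋.sub2 b (𝕋.pr true) c := rfl
  have inf_def (b c : 𝕋.T Bool) : b ⊓ c = 𝕋.sub2 b c (𝕋.pr false) := rfl
  letI : Lattice (𝕋.T Bool) := Lattice.mk'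
    (fun b c => by
      have h := sub2_comm hyp c b (𝕋.pr true) (𝕋.pr true) (𝕋.pr true) (𝕋.pr false)
      rwa [idem, idem, sub2_pr_pr, sub2_pr_pr] at h)
    (fun a b c => by simp only [sup_def, sub2_sub2, sub2_pr_true])
    (fun b c => by
      have h := sub2_comm hyp c b (𝕋.pr true) (𝕋.pr false) (𝕋.pr false) (𝕋.pr false)
      rwa [idem, idem, sub2_pr_pr, sub2_pr_pr] at h)
    (fun a b c => by simp only [inf_def, sub2_sub2, sub2_pr_false])
    (fun a b => by rw [sup_def, inf_def, (hyp _ a).sub2_right, sub2_pr_pr])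
    (fun a b => by rw [sup_def, inf_def, (hyp _ a).sub2_left, sub2_pr_pr])
  { (inferInstance : Lattice (𝕋.T Bool)) with
    top := 𝕋.pr true
    bot := 𝕋.pr false
    compl b := 𝕋.sub2 b (𝕋.pr false) (𝕋.pr true)
    le_sup_inf := fun a b c => by
      refine le_of_eq ?_
      have h := sub2_comm hyp a b (𝕋.pr true) (𝕋.pr false) c (𝕋.pr false)
      rw [idem, sub2_pr_pr] at h
      simp only [sup_def, inf_def, sub2_sub2, sub2_pr_true]
      rw [(hyp _ a).sub2_left, h, (hyp _ a).sub2_right]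
    inf_compl_le_bot := fun b => by
      refine le_of_eq ?_
      change 𝕋.sub2 b (𝕋.sub2 b (𝕋.pr false) (𝕋.pr true)) (𝕋.pr false) = 𝕋.pr false
      rw [(hyp _ b).sub2_left, idem]
    top_le_sup_compl := fun b => by
      refine le_of_eq ?_
      change 𝕋.pr true = 𝕋.sub2 b (𝕋.pr true) (𝕋.sub2 b (𝕋.pr false) (𝕋.pr true))
      rw [(hyp _ b).sub2_right, idem]
    le_top := fun b => sup_eq_right.mp (idem b _)
    bot_le := fun b => sup_eq_right.mp (𝕋.sub2_pr_false _ b) }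

end AlgTheory

/-- For a non-degenerate hyperaffine theory `𝕋`, the set `T 2` underlies a
non-degenerate Boolean algebra with `1 = π₁`, `0 = π₂`, and meet, join and
complement given by substitution. -/
theorem hyperaffine_T2_booleanAlgebra (𝕋 : AlgTheory)
    (nondeg : (𝕋.pr true : 𝕋.T Bool) ≠ 𝕋.pr false)
    (hyp : ∀ (I : Type) (t : 𝕋.T I), 𝕋.IsHyperaffine t) :
    ∃ inst : BooleanAlgebra (𝕋.T Bool),
      haveI := inst
      ((⊤ : 𝕋.T Bool) = 𝕋.pr true ∧
       (⊥ : 𝕋.T Bool) = 𝕋.pr false ∧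
       (⊥ : 𝕋.T Bool) ≠ (⊤ : 𝕋.T Bool) ∧
       (∀ b c : 𝕋.T Bool,
          b ⊓ c = 𝕋.sub2 b (𝕋.sub2 c (𝕋.pr true) (𝕋.pr false)) (𝕋.pr false)) ∧
       (∀ b c : 𝕋.T Bool,
          b ⊔ c = 𝕋.sub2 b (𝕋.pr true) (𝕋.sub2 c (𝕋.pr true) (𝕋.pr false))) ∧
       (∀ b : 𝕋.T Bool, bᶜ = 𝕋.sub2 b (𝕋.pr false) (𝕋.pr true))) := by
  refine ⟨AlgTheory.booleanAlgebra hyp, rfl, rfl, nondeg.symm, fun b c => ?_, fun b c => ?_,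
    fun b => rfl⟩
  all_goals
    rw [AlgTheory.sub2_pr_pr]
    rfl
end

section
/- Let ℍ⋈M be a matched pair of theories. Define, for each set I, T(I) = H(I) × M, with projections π_i = (π_i, 1) and substitution (h,m)((k,n)) = ( h(λi. m*k_i), h ▷ (λi. m·n_i) ) for (h,m) ∈ T(I) and (k_i, n_i) ∈ T(J) for each i ∈ I. Then these data form an algebraic theory ℍ⋈M (the bicrossed product), whose hyperaffine operations are exactly those of the form (h, 1) and whose unary operations T(1) are exactly those of the form (π_1, m); moreover ℍ⋈M is hyperaffine–unary: every (h,m) ∈ T(I) decomposes uniquely as the hyperaffine (h,1) applied to the unary (π_1,m). -/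
section Bicrossed

variable (H : AlgTheory) (M : Type) [Monoid M]

/-- Projections of the bicrossed product `ℍ ⋈ M`: `π_i = (π_i, 1)`. -/
def bpr {I : Type} (i : I) : H.T I × M := (H.pr i, 1)

/-- Substitution of the bicrossed product `ℍ ⋈ M`:
`(h,m)((k,n)) = (h(λi. m*k_i), h ▷ (λi. m·n_i))`. -/
def bsubst (star : ∀ {I : Type}, M → H.T I → H.T I)
    (tri : ∀ {I : Type}, H.T I → (I → M) → M)
    {I J : Type} (t : H.T I × M) (u : I → H.T J × M) : H.T J × M :=
  (H.subst t.1 (fun i => star t.2 (u i).1), tri t.1 (fun i => t.2 * (u i).2))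

/-- Hyperaffineness of an operation of the bicrossed product `ℍ ⋈ M`. -/
def IsBHyper (star : ∀ {I : Type}, M → H.T I → H.T I)
    (tri : ∀ {I : Type}, H.T I → (I → M) → M)
    {I : Type} (t : H.T I × M) : Prop :=
  bsubst H M star tri t (fun _ : I => bpr H M PUnit.unit) = bpr H M PUnit.unit ∧
  bsubst H M star tri t
      (fun i => bsubst H M star tri t (fun j => bpr H M (i, j))) =
    bsubst H M star tri t (fun i => bpr H M (i, i))

end Bicrossed

namespace AlgTheory

variable {H : AlgTheory} {I J : Type}

theorem IsAffine.subst_const_s17 {h : H.T I} (hh : H.IsAffine h) (c : H.T J) :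
    H.subst h (fun _ => c) = c := by
  have := congrArg (fun t => H.subst t fun _ => c) hh
  simpa only [H.subst_assoc, H.pr_subst] using this

theorem IsAffine.eq_pr {h : H.T PUnit} (hh : H.IsAffine h) : h = H.pr PUnit.unit :=
  (H.subst_pr h).symm.trans hh

/-- In a hyperaffine theory, an inner occurrence of `h` may be replaced by the value chosen by an
enclosing occurrence of `h`, even across an operation depending on that value. -/
theorem subst_diagonal (hH : ∀ (I : Type) (h : H.T I), H.IsHyperaffine h)
    (h : H.T I) (k : I → H.T J) :
    H.subst h (fun i => H.subst (k i) fun j => H.subst h fun i' => H.pr ((i, j), i')) =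
      H.subst h fun i => H.subst (k i) fun j => H.pr ((i, j), i) := by
  have := congrArg (fun t => H.subst t fun p : (I × J) × (I × J) => H.pr (p.1, p.2.1))
    (hH _ (H.subst h fun i => H.subst (k i) fun j => H.pr (i, j))).2
  simpa only [H.subst_assoc, H.pr_subst, (hH _ _).1.subst_const_s17] using this

end AlgTheory

/-- Given a matched pair of theories `ℍ ⋈ M`, the sets `T I = H I × M` with
the above projections and substitution form an algebraic theory, the bicrossed
product, whose hyperaffine operations are exactly those of the form `(h, 1)`,
whose unary operations are exactly those of the form `(π₁, m)`, and which is
hyperaffine–unary. -/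
theorem bicrossed_product_theory
    (H : AlgTheory) (hH : ∀ (I : Type) (h : H.T I), H.IsHyperaffine h)
    (M : Type) [Monoid M]
    (star : ∀ {I : Type}, M → H.T I → H.T I)
    (tri : ∀ {I : Type}, H.T I → (I → M) → M)
    -- (i) each `m*(−)` is a theory homomorphism
    (ax1 : ∀ (I : Type) (m : M) (i : I), star m (H.pr i : H.T I) = H.pr i)
    (ax2 : ∀ (I J : Type) (m : M) (h : H.T I) (k : I → H.T J),
      star m (H.subst h k) = H.subst (star m h) (fun i => star m (k i)))
    -- (ii) these form an `M`-action on `ℍ`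
    (ax3 : ∀ (I : Type) (h : H.T I), star (1 : M) h = h)
    (ax4 : ∀ (I : Type) (m n : M) (h : H.T I), star m (star n h) = star (m * n) h)
    -- (iii) `▷` makes `M` an `ℍ`-model
    (ax5 : ∀ (I : Type) (i : I) (m : I → M), tri (H.pr i : H.T I) m = m i)
    (ax6 : ∀ (I J : Type) (h : H.T I) (k : I → H.T J) (m : J → M),
      tri (H.subst h k) m = tri h (fun i => tri (k i) m))
    -- (iv) right multiplication is an `ℍ`-model homomorphism
    (ax7 : ∀ (I : Type) (h : H.T I) (m : I → M) (n : M),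
      tri h m * n = tri h (fun i => m i * n))
    -- (v) left multiplication is an `ℍ`-model homomorphism into the pullback
    (ax8 : ∀ (I : Type) (h : H.T I) (m : I → M) (n : M),
      n * tri h m = tri (star n h) (fun i => n * m i))
    -- (vi) `(−)*h` is an `ℍ`-model homomorphism
    (ax9 : ∀ (I J : Type) (h : H.T I) (k : H.T J) (m : J → M),
      star (tri k m) h = H.subst k (fun j => star (m j) h)) :
    -- theory axioms
    (∀ (I : Type) (t : H.T I × M),
      bsubst H M star tri t (fun i => bpr H M i) = t) ∧
    (∀ (I J : Type) (i : I) (u : I → H.T J × M),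
      bsubst H M star tri (bpr H M i) u = u i) ∧
    (∀ (I J K : Type) (t : H.T I × M) (u : I → H.T J × M) (v : J → H.T K × M),
      bsubst H M star tri (bsubst H M star tri t u) v =
        bsubst H M star tri t (fun i => bsubst H M star tri (u i) v)) ∧
    -- the hyperaffine operations are exactly those of the form `(h, 1)`
    (∀ (I : Type) (t : H.T I × M), IsBHyper H M star tri t ↔ t.2 = 1) ∧
    -- the unary operations are exactly those of the form `(π₁, m)`
    (∀ t : H.T PUnit × M, t.1 = H.pr PUnit.unit) ∧
    -- hyperaffine–unary decomposition, and its uniqueness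
    (∀ (I : Type) (t : H.T I × M),
      (IsBHyper H M star tri (t.1, (1 : M)) ∧
        t = bsubst H M star tri (t.1, (1 : M))
              (fun i => bsubst H M star tri ((H.pr PUnit.unit : H.T PUnit), t.2)
                (fun _ => bpr H M i))) ∧
      (∃! p : (H.T I × M) × (H.T PUnit × M),
        IsBHyper H M star tri p.1 ∧
        t = bsubst H M star tri p.1
              (fun i => bsubst H M star tri p.2 (fun _ => bpr H M i)))) := by
  have triConst : ∀ (I : Type) (h : H.T I) (m : M), tri h (fun _ => m) = m := by
    intro I h m
    have := congrArg (fun t => tri t fun _ => m) (hH I h).1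
    simpa only [ax6, ax5] using this
  have hyper : ∀ (I : Type) (t : H.T I × M), IsBHyper H M star tri t ↔ t.2 = 1 := by
    rintro I ⟨h, m⟩
    constructor
    · intro ht
      simpa only [bsubst, bpr, mul_one, triConst] using congrArg Prod.snd ht.1
    · rintro rfl
      refine ⟨Prod.ext ?_ ?_, Prod.ext ?_ ?_⟩
      · simpa only [bsubst, bpr, ax3] using (hH I h).1.subst_const_s17 _
      · simp only [bsubst, bpr, mul_one, triConst]
      · simpa only [bsubst, bpr, ax3] using (hH I h).2
      · simp only [bsubst, bpr, mul_one, triConst]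
  have unary : ∀ t : H.T PUnit × M, t.1 = H.pr PUnit.unit := fun t => (hH _ t.1).1.eq_pr
  have decomp : ∀ (I : Type) (h : H.T I) (m : M),
      bsubst H M star tri (h, (1 : M))
        (fun i => bsubst H M star tri ((H.pr PUnit.unit : H.T PUnit), m)
          (fun _ => bpr H M i)) = (h, m) := by
    intro I h m
    simp only [bsubst, bpr, ax1, ax5, H.pr_subst, H.subst_pr, mul_one, one_mul, triConst]
  refine ⟨?_, ?_, ?_, hyper, unary, ?_⟩
  · rintro I ⟨h, m⟩
    simp only [bsubst, bpr, ax1, H.subst_pr, mul_one, triConst]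
  · intro I J i u
    simp only [bsubst, bpr, H.pr_subst, ax3, ax5, one_mul]
  · rintro I J K ⟨h, m⟩ u v
    have diag := AlgTheory.subst_diagonal hH h fun i => star m (u i).1
    refine Prod.ext ?_ ?_
    · have := congrArg (fun t => H.subst t fun p : (I × J) × I =>
        star (m * (u p.2).2) (v p.1.2).1) diag
      simpa only [bsubst, H.subst_assoc, H.pr_subst, ax2, ax4, ax9] using this
    · have := congrArg (fun t => tri t fun p : (I × J) × I =>
        m * (u p.2).2 * (v p.1.2).2) diag
      simpa only [bsubst, ax5, ax6, ax7, ax8, mul_assoc] using this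
  · rintro I ⟨h, m⟩
    refine ⟨⟨(hyper _ _).2 rfl, (decomp I h m).symm⟩,
      ((h, 1), (H.pr PUnit.unit, m)), ⟨(hyper _ _).2 rfl, (decomp I h m).symm⟩, ?_⟩
    rintro ⟨⟨h', n⟩, ⟨u, m'⟩⟩ ⟨hp, ht⟩
    obtain rfl : n = 1 := (hyper _ _).1 hp
    obtain rfl : u = H.pr PUnit.unit := unary (u, m')
    obtain ⟨rfl, rfl⟩ := Prod.mk.inj (ht.trans (decomp I h' m'))
    rfl
end

section
/- Let B⋈M be a non-degenerate matched pair of algebras and let Y, Z be B⋈M-sets. Let Z^Y be the set of B⋈M-set homomorphisms f : M × Y → Z (where M × Y carries the componentwise B⋈M-set structure, M being a B⋈M-set via its B-set structure and left multiplication), equipped with the M-action (m • f)(n, y) = f(nm, y) and the B-set operation b(f,g)(m,y) = (m*b)(f(m,y), g(m,y)). Then: (1) Z^Y is a B⋈M-set; (2) ev : Z^Y × Y → Z, ev(f,y) = f(1,y), is a B⋈M-set homomorphism; and (3) for every B⋈M-set X and every B⋈M-set homomorphism f : X × Y → Z there is a unique B⋈M-set homomorphism f̄ : X → Z^Y with ev(f̄(x),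 y) = f(x, y), namely f̄(x)(m,y) = f(m·x, y). Hence the category of B⋈M-sets is cartesian closed. -/
/-- The product of two `B`-sets, with componentwise operations. -/
def prodBSet {B X Y : Type} [BooleanAlgebra B]
    (SX : BSetStruct B X) (SY : BSetStruct B Y) : BSetStruct B (X × Y) where
  act b p q := (SX.act b p.1 q.1, SY.act b p.2 q.2)
  act_refl b x := by simp [SX.act_refl, SY.act_refl]
  act_absorb_left b x y z := by simp [SX.act_absorb_left, SY.act_absorb_left]
  act_absorb_right b x y z := by simp [SX.act_absorb_right, SY.act_absorb_right]
  act_top x y := by simp [SX.act_top, SY.act_top]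
  act_compl b x y := by simp [SX.act_compl, SY.act_compl]
  act_inf b c x y := by simp [SX.act_inf, SY.act_inf]

section BM

variable (B : Type) [BooleanAlgebra B] (M : Type) [Monoid M]
  (SM : BSetStruct B M) (star : M → B → B)

/-- A `B⋈M`-set, for a matched pair of algebras given by a `B`-set structure
`SM` on `M` and an `M`-action `star` on `B`: a set `X` with a `B`-set
structure and a left `M`-action satisfying `b(m,n)·x = b(m·x, n·x)` and
`m·b(x,y) = (m*b)(m·x, m·y)`. -/
structure BMSet (X : Type) where
  bset : BSetStruct B X
  smul : M → X → X
  one_smul : ∀ x, smul 1 x = x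
  mul_smul : ∀ m n x, smul (m * n) x = smul m (smul n x)
  compat_act : ∀ b m n x, smul (SM.act b m n) x = bset.act b (smul m x) (smul n x)
  compat_smul : ∀ m b x y, smul m (bset.act b x y) = bset.act (star m b) (smul m x) (smul m y)

variable {B M SM star}

/-- A homomorphism of `B⋈M`-sets: simultaneously a `B`-set homomorphism and an
`M`-equivariant map. -/
def IsBMSetHom {X Y : Type} (SX : BMSet B M SM star X) (SY : BMSet B M SM star Y)
    (f : X → Y) : Prop :=
  IsBSetHom SX.bset SY.bset f ∧ ∀ m x, f (SX.smul m x) = SY.smul m (f x)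

/-- The product of two `B⋈M`-sets, with componentwise structure. -/
def prodBMSet {X Y : Type} (SX : BMSet B M SM star X) (SY : BMSet B M SM star Y) :
    BMSet B M SM star (X × Y) where
  bset := prodBSet SX.bset SY.bset
  smul m p := (SX.smul m p.1, SY.smul m p.2)
  one_smul p := by simp [SX.one_smul, SY.one_smul]
  mul_smul m n p := by simp [SX.mul_smul, SY.mul_smul]
  compat_act b m n p := by simp [prodBSet, SX.compat_act, SY.compat_act]
  compat_smul m b p q := by simp [prodBSet, SX.compat_smul, SY.compat_smul]

/-- `M` itself is a `B⋈M`-set, via its `B`-set structure and left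
multiplication. -/
def selfBMSet
    (c1 : ∀ (b : B) (m n p : M), SM.act b m n * p = SM.act b (m * p) (n * p))
    (c2 : ∀ (m : M) (b : B) (n p : M),
      m * SM.act b n p = SM.act (star m b) (m * n) (m * p)) :
    BMSet B M SM star M where
  bset := SM
  smul m n := m * n
  one_smul := one_mul
  mul_smul := mul_assoc
  compat_act b m n x := c1 b m n x
  compat_smul m b x y := c2 m b x y

end BM

namespace BSetStruct

variable {B X : Type} [BooleanAlgebra B] (S : BSetStruct B X)

/-- Two elements agree if they agree both on `b` and on its complement. -/
theorem eq_of_act_eq (b : B) {x y : X} (h : ∀ w, S.act b x w = S.act b y w)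
    (h' : ∀ w, S.act bᶜ x w = S.act bᶜ y w) : x = y := by
  have h₁ : S.act b x x = S.act b y x := h x
  have h₂ : S.act b y x = S.act b y y := by simpa only [S.act_compl] using h' y
  rw [← S.act_refl b x, h₁, h₂, S.act_refl]

theorem act_act_inf (c a : B) (p q w : X) :
    S.act c (S.act (c ⊓ a) p q) w = S.act c (S.act a p q) w := by
  rw [S.act_inf, S.act_absorb_left]

/-- On `c`, the operation `a` depends only on `c ⊓ a`. -/
theorem act_act_congr {c a d : B} (h : c ⊓ a = c ⊓ d) (p q w : X) :
    S.act c (S.act a p q) w = S.act c (S.act d p q) w := by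
  rw [← S.act_act_inf c a, h, S.act_act_inf]

theorem act_act_localize_left (c d : B) (p q v w : X) :
    S.act c (S.act d (S.act c p v) q) w = S.act c (S.act d p q) w := by
  rw [← S.act_act_inf c d, inf_comm, S.act_inf, S.act_absorb_left, ← S.act_inf, inf_comm,
    S.act_act_inf]

theorem act_act_localize_right (c d : B) (p q v w : X) :
    S.act c (S.act d p (S.act c q v)) w = S.act c (S.act d p q) w := by
  rw [← S.act_compl d, S.act_act_localize_left, S.act_compl]

theorem act_ite (c d e : B) (x x' y y' : X) :
    S.act ((c ⊓ d) ⊔ (cᶜ ⊓ e)) (S.act c x x') (S.act c y y') =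
      S.act c (S.act d x y) (S.act e x' y') := by
  have h₁ : c ⊓ ((c ⊓ d) ⊔ (cᶜ ⊓ e)) = c ⊓ d := by
    rw [inf_sup_left, ← inf_assoc, ← inf_assoc]; simp
  have h₂ : cᶜ ⊓ ((c ⊓ d) ⊔ (cᶜ ⊓ e)) = cᶜ ⊓ e := by
    rw [inf_sup_left, ← inf_assoc, ← inf_assoc]; simp
  apply S.eq_of_act_eq c <;> intro w
  · rw [S.act_act_congr h₁, S.act_act_localize_left, S.act_act_localize_right,
      S.act_absorb_left]
  · rw [S.act_act_congr h₂, ← S.act_compl c x', ← S.act_compl c y', S.act_act_localize_left,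
      S.act_act_localize_right, ← S.act_compl c (S.act e x' y'), S.act_absorb_left]

end BSetStruct

section Exponential

variable {B : Type} [BooleanAlgebra B] {M : Type} [Monoid M]
  {SM : BSetStruct B M} {star : M → B → B}
  {c1 : ∀ (b : B) (m n p : M), SM.act b m n * p = SM.act b (m * p) (n * p)}
  {c2 : ∀ (m : M) (b : B) (n p : M),
    m * SM.act b n p = SM.act (star m b) (m * n) (m * p)}
  {X Y Z : Type} {SX : BMSet B M SM star X} {SY : BMSet B M SM star Y}
  {SZ : BMSet B M SM star Z}

theorem isBMSetHom_translate {f : M × Y → Z}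
    (hf : IsBMSetHom (prodBMSet (selfBMSet c1 c2) SY) SZ f) (m : M) :
    IsBMSetHom (prodBMSet (selfBMSet c1 c2) SY) SZ (fun p => f (p.1 * m, p.2)) := by
  constructor
  · rintro b ⟨n, y⟩ ⟨n', y'⟩
    change f (SM.act b n n' * m, SY.bset.act b y y') = _
    rw [c1]
    exact hf.1 b (n * m, y) (n' * m, y')
  · rintro k ⟨n, y⟩
    change f (k * n * m, SY.smul k y) = _
    rw [mul_assoc]
    exact hf.2 k (n * m, y)

theorem isBMSetHom_act
    (star_mul : ∀ (m n : M) (b : B), star (m * n) b = star m (star n b))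
    (c3 : ∀ (b : B) (m n : M) (c : B),
      star (SM.act b m n) c = (b ⊓ star m c) ⊔ (bᶜ ⊓ star n c))
    {f g : M × Y → Z}
    (hf : IsBMSetHom (prodBMSet (selfBMSet c1 c2) SY) SZ f)
    (hg : IsBMSetHom (prodBMSet (selfBMSet c1 c2) SY) SZ g) (b : B) :
    IsBMSetHom (prodBMSet (selfBMSet c1 c2) SY) SZ
      (fun p => SZ.bset.act (star p.1 b) (f p) (g p)) := by
  constructor
  · intro c p q
    change SZ.bset.act (star (SM.act c p.1 q.1) b) _ _ = _
    rw [hf.1, hg.1, c3, SZ.bset.act_ite]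
  · intro k p
    change SZ.bset.act (star (k * p.1) b) _ _ = _
    rw [hf.2, hg.2, star_mul, SZ.compat_smul]

theorem isBMSetHom_transpose {f : X × Y → Z} (hf : IsBMSetHom (prodBMSet SX SY) SZ f) (x : X) :
    IsBMSetHom (prodBMSet (selfBMSet c1 c2) SY) SZ (fun p => f (SX.smul p.1 x, p.2)) := by
  constructor
  · rintro b ⟨n, y⟩ ⟨n', y'⟩
    change f (SX.smul (SM.act b n n') x, SY.bset.act b y y') = _
    rw [SX.compat_act]
    exact hf.1 b (SX.smul n x, y) (SX.smul n' x, y')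
  · rintro k ⟨n, y⟩
    change f (SX.smul (k * n) x, SY.smul k y) = _
    rw [SX.mul_smul]
    exact hf.2 k (SX.smul n x, y)

/-- The exponential `Z^Y` of `B⋈M`-sets. -/
def expBMSet
    (star_mul : ∀ (m n : M) (b : B), star (m * n) b = star m (star n b))
    (star_top : ∀ m : M, star m ⊤ = ⊤)
    (star_inf : ∀ (m : M) (b c : B), star m (b ⊓ c) = star m b ⊓ star m c)
    (star_compl : ∀ (m : M) (b : B), star m bᶜ = (star m b)ᶜ)
    (c1 : ∀ (b : B) (m n p : M), SM.act b m n * p = SM.act b (m * p) (n * p))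
    (c2 : ∀ (m : M) (b : B) (n p : M),
      m * SM.act b n p = SM.act (star m b) (m * n) (m * p))
    (c3 : ∀ (b : B) (m n : M) (c : B),
      star (SM.act b m n) c = (b ⊓ star m c) ⊔ (bᶜ ⊓ star n c))
    (SY : BMSet B M SM star Y) (SZ : BMSet B M SM star Z) :
    BMSet B M SM star
      {f : M × Y → Z // IsBMSetHom (prodBMSet (selfBMSet c1 c2) SY) SZ f} where
  bset :=
    { act := fun b f g => ⟨_, isBMSetHom_act star_mul c3 f.2 g.2 b⟩
      act_refl := fun b f => by ext p; exact SZ.bset.act_refl _ _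
      act_absorb_left := fun b f g h => by ext p; exact SZ.bset.act_absorb_left _ _ _ _
      act_absorb_right := fun b f g h => by ext p; exact SZ.bset.act_absorb_right _ _ _ _
      act_top := fun f g => by ext p; simp only [star_top, SZ.bset.act_top]
      act_compl := fun b f g => by ext p; simp only [star_compl, SZ.bset.act_compl]
      act_inf := fun b c f g => by ext p; simp only [star_inf, SZ.bset.act_inf] }
  smul m f := ⟨_, isBMSetHom_translate f.2 m⟩
  one_smul f := by ext p; simp only [mul_one]
  mul_smul m n f := by ext p; simp only [mul_assoc]
  compat_act b m n f := by
    ext ⟨k, y⟩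
    change f.1 (k * SM.act b m n, y) =
      SZ.bset.act (star k b) (f.1 (k * m, y)) (f.1 (k * n, y))
    rw [c2, ← f.2.1]
    change _ = f.1 (SM.act _ _ _, SY.bset.act _ y y)
    rw [SY.bset.act_refl]
  compat_smul m b f g := by ext p; simp only [star_mul]

end Exponential

/-- The variety of `B⋈M`-sets for a non-degenerate matched pair of algebras
`B⋈M` is cartesian closed: the set `Z^Y` of `B⋈M`-set homomorphisms
`M × Y → Z`, under the `M`-action `(m • f)(n,y) = f(nm, y)` and the `B`-set
operation `b(f,g)(m,y) = (m*b)(f(m,y), g(m,y))`, is a `B⋈M`-set; evaluation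
`ev(f,y) = f(1,y)` is a homomorphism; and every homomorphism `f : X × Y → Z`
has a unique transpose `f̄ : X → Z^Y` with `ev(f̄ x, y) = f(x,y)`, namely
`f̄(x)(m,y) = f(m·x, y)`. -/
theorem bmset_cartesian_closed (B : Type) [BooleanAlgebra B]
    (nondeg : (⊥ : B) ≠ ⊤) (M : Type) [Monoid M]
    (SM : BSetStruct B M) (star : M → B → B)
    -- `star` is a monoid action of `M` on `B`
    (star_one : ∀ b : B, star 1 b = b)
    (star_mul : ∀ (m n : M) (b : B), star (m * n) b = star m (star n b))
    -- ... by Boolean algebra homomorphisms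
    (star_top : ∀ m : M, star m ⊤ = ⊤)
    (star_bot : ∀ m : M, star m ⊥ = ⊥)
    (star_inf : ∀ (m : M) (b c : B), star m (b ⊓ c) = star m b ⊓ star m c)
    (star_sup : ∀ (m : M) (b c : B), star m (b ⊔ c) = star m b ⊔ star m c)
    (star_compl : ∀ (m : M) (b : B), star m bᶜ = (star m b)ᶜ)
    -- the matched pair axioms
    (c1 : ∀ (b : B) (m n p : M), SM.act b m n * p = SM.act b (m * p) (n * p))
    (c2 : ∀ (m : M) (b : B) (n p : M),
      m * SM.act b n p = SM.act (star m b) (m * n) (m * p))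
    (c3 : ∀ (b : B) (m n : M) (c : B),
      star (SM.act b m n) c = (b ⊓ star m c) ⊔ (bᶜ ⊓ star n c))
    (Y Z : Type) (SY : BMSet B M SM star Y) (SZ : BMSet B M SM star Z) :
    ∃ SE : BMSet B M SM star
        {f : M × Y → Z //
          IsBMSetHom (prodBMSet (selfBMSet c1 c2) SY) SZ f},
      -- the `M`-action of `Z^Y`
      (∀ (m : M) (f : {f : M × Y → Z //
            IsBMSetHom (prodBMSet (selfBMSet c1 c2) SY) SZ f}) (n : M) (y : Y),
        (SE.smul m f).1 (n, y) = f.1 (n * m, y)) ∧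
      -- the `B`-set structure of `Z^Y`
      (∀ (b : B) (f g : {f : M × Y → Z //
            IsBMSetHom (prodBMSet (selfBMSet c1 c2) SY) SZ f}) (m : M) (y : Y),
        (SE.bset.act b f g).1 (m, y) =
          SZ.bset.act (star m b) (f.1 (m, y)) (g.1 (m, y))) ∧
      -- evaluation is a homomorphism
      IsBMSetHom (prodBMSet SE SY) SZ (fun p => p.1.1 (1, p.2)) ∧
      -- unique transposition, given by `f̄(x)(m,y) = f(m·x, y)`
      (∀ (X : Type) (SX : BMSet B M SM star X) (f : X × Y → Z),
        IsBMSetHom (prodBMSet SX SY) SZ f →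
        (∃! g : X → {f : M × Y → Z //
            IsBMSetHom (prodBMSet (selfBMSet c1 c2) SY) SZ f},
          IsBMSetHom SX SE g ∧ ∀ (x : X) (y : Y), (g x).1 (1, y) = f (x, y)) ∧
        (∀ g : X → {f : M × Y → Z //
            IsBMSetHom (prodBMSet (selfBMSet c1 c2) SY) SZ f},
          IsBMSetHom SX SE g → (∀ (x : X) (y : Y), (g x).1 (1, y) = f (x, y)) →
          ∀ (x : X) (m : M) (y : Y), (g x).1 (m, y) = f (SX.smul m x, y))) := by
  let SE := expBMSet star_mul star_top star_inf star_compl c1 c2 c3 SY SZ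
  have transpose_eq : ∀ (X : Type) (SX : BMSet B M SM star X) (f : X × Y → Z)
      (g : X → {f : M × Y → Z // IsBMSetHom (prodBMSet (selfBMSet c1 c2) SY) SZ f}),
      IsBMSetHom SX SE g → (∀ (x : X) (y : Y), (g x).1 (1, y) = f (x, y)) →
      ∀ (x : X) (m : M) (y : Y), (g x).1 (m, y) = f (SX.smul m x, y) := by
    intro X SX f g hg hev x m y
    rw [← hev, hg.2]
    change _ = (g x).1 (1 * m, y)
    rw [one_mul]
  refine ⟨SE, fun _ _ _ _ => rfl, fun _ _ _ _ _ => rfl, ⟨?_, ?_⟩, ?_⟩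
  · rintro b ⟨f, y⟩ ⟨g, z⟩
    have key : ∀ h : {f : M × Y → Z // IsBMSetHom (prodBMSet (selfBMSet c1 c2) SY) SZ f},
        h.1 (1, SY.bset.act b y z) = SZ.bset.act b (h.1 (1, y)) (h.1 (1, z)) := by
      intro h
      rw [← h.2.1]
      change _ = h.1 (SM.act b 1 1, SY.bset.act b y z)
      rw [SM.act_refl]
    change SZ.bset.act (star 1 b) (f.1 (1, SY.bset.act b y z)) (g.1 (1, SY.bset.act b y z)) =
      SZ.bset.act b (f.1 (1, y)) (g.1 (1, z))
    rw [star_one, key, key, SZ.bset.act_absorb_left, SZ.bset.act_absorb_right]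
  · rintro m ⟨f, y⟩
    change f.1 (1 * m, SY.smul m y) = SZ.smul m (f.1 (1, y))
    rw [← f.2.2]
    change _ = f.1 (m * 1, SY.smul m y)
    rw [one_mul, mul_one]
  · intro X SX f hf
    refine ⟨⟨fun x => ⟨_, isBMSetHom_transpose hf x⟩, ⟨⟨?_, ?_⟩, ?_⟩, ?_⟩,
      transpose_eq X SX f⟩
    · intro b x x'
      ext ⟨m, y⟩
      change f (SX.smul m (SX.bset.act b x x'), y) =
        SZ.bset.act (star m b) (f (SX.smul m x, y)) (f (SX.smul m x', y))
      rw [SX.compat_smul, ← hf.1]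
      change _ = f (SX.bset.act _ _ _, SY.bset.act _ y y)
      rw [SY.bset.act_refl]
    · intro m x
      ext ⟨n, y⟩
      change f (SX.smul n (SX.smul m x), y) = f (SX.smul (n * m) x, y)
      rw [SX.mul_smul]
    · intro x y
      simp only [SX.one_smul]
    · rintro g ⟨hg, hev⟩
      funext x
      ext ⟨m, y⟩
      exact transpose_eq X SX f g hg hev x m y
end

section
/- Let 𝒞 be a category with finite products and all set-indexed copowers, such that for every X ∈ 𝒞 the functor (−) × X preserves copowers. Then for any X ∈ 𝒞, the complete theory of dual operations 𝕋_X — with T_X(I) = 𝒞(X, I·X), projections the coprojections ι_i : X → I·X, and substitution (t,u) ↦ ⟨u_i⟩_{i∈I} ∘ t — is a hyperaffine–unary algebraic theory: every t ∈ T_X(I) admits a unique decomposition t = h(λi. m) with h hyperaffine and m ∈ T_X(1). -/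
open CategoryTheory CategoryTheory.Limits

noncomputable section

variable (𝒞 : Type u) [Category.{v} 𝒞]
  [HasFiniteProducts 𝒞]
  [∀ (I : Type) (C : 𝒞), HasCoproduct (fun _ : I => C)]

/-- Hyperaffineness of an operation `t ∈ T_X(I) = 𝒞(X, I·X)` of the complete
theory of dual operations of `X`: `t` is affine (`t(λi.π₁) = π₁` in `T_X(1)`)
and `t(λi. t(λj. π_{(i,j)})) = t(λi. π_{(i,i)})` in `T_X(I × I)`. -/
def IsHyperaffineDualOp {X : 𝒞} {I : Type} (t : X ⟶ ∐ fun _ : I => X) : Prop :=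
  (t ≫ Sigma.desc (fun _ : I => Sigma.ι (fun _ : PUnit => X) PUnit.unit) =
      Sigma.ι (fun _ : PUnit => X) PUnit.unit) ∧
  (t ≫ Sigma.desc (fun i : I =>
        t ≫ Sigma.desc (fun j : I => Sigma.ι (fun _ : I × I => X) (i, j))) =
    t ≫ Sigma.desc (fun i : I => Sigma.ι (fun _ : I × I => X) (i, i)))

variable {𝒞}

/-- The map `I·Y ⟶ I·1` induced by `Y ⟶ 1`. -/
def copowerIndex (I : Type) (Y : 𝒞) : (∐ fun _ : I => Y) ⟶ ∐ fun _ : I => ⊤_ 𝒞 :=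
  Sigma.desc fun i => terminal.from Y ≫ Sigma.ι (fun _ : I => ⊤_ 𝒞) i

/-- The codiagonal `I·Y ⟶ Y`. -/
def copowerFold (I : Type) (Y : 𝒞) : (∐ fun _ : I => Y) ⟶ Y :=
  Sigma.desc fun _ => 𝟙 Y

@[simp]
lemma ι_copowerIndex {I : Type} (Y : 𝒞) (i : I) :
    Sigma.ι (fun _ : I => Y) i ≫ copowerIndex I Y =
      terminal.from Y ≫ Sigma.ι (fun _ : I => ⊤_ 𝒞) i := by
  simp [copowerIndex]

omit [HasFiniteProducts 𝒞] in
@[simp]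
lemma ι_copowerFold {I : Type} (Y : 𝒞) (i : I) :
    Sigma.ι (fun _ : I => Y) i ≫ copowerFold I Y = 𝟙 Y := by
  simp [copowerFold]

@[simp]
lemma ι_copowerIndex_assoc {I : Type} (Y : 𝒞) (i : I) {Z : 𝒞} (f : (∐ fun _ : I => ⊤_ 𝒞) ⟶ Z) :
    Sigma.ι (fun _ : I => Y) i ≫ copowerIndex I Y ≫ f =
      terminal.from Y ≫ Sigma.ι (fun _ : I => ⊤_ 𝒞) i ≫ f := by
  simp [copowerIndex]

omit [HasFiniteProducts 𝒞] in
@[simp]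
lemma ι_copowerFold_assoc {I : Type} (Y : 𝒞) (i : I) {Z : 𝒞} (f : Y ⟶ Z) :
    Sigma.ι (fun _ : I => Y) i ≫ copowerFold I Y ≫ f = f := by
  simp [copowerFold]

omit [HasFiniteProducts 𝒞] in
lemma desc_const_eq_copowerFold_comp {I : Type} {Y Z : 𝒞} (f : Y ⟶ Z) :
    Sigma.desc (fun _ : I => f) = copowerFold I Y ≫ f :=
  Sigma.hom_ext _ _ fun i => by simp

lemma isIso_lift_copowerIndex_copowerFold
    (copower_preserved : ∀ (I : Type) (C X : 𝒞),
      IsIso ((Sigma.desc fun i : I =>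
          prod.map (Sigma.ι (fun _ : I => C) i) (𝟙 X)) :
        (∐ fun _ : I => C ⨯ X) ⟶ (∐ fun _ : I => C) ⨯ X))
    (I : Type) (Y : 𝒞) :
    IsIso (prod.lift (copowerIndex I Y) (copowerFold I Y)) := by
  have := copower_preserved I (⊤_ 𝒞) Y
  let e : (∐ fun _ : I => Y) ≅ ∐ fun _ : I => (⊤_ 𝒞) ⨯ Y :=
    { hom := Sigma.desc fun i =>
        prod.lift (terminal.from Y) (𝟙 Y) ≫ Sigma.ι (fun _ : I => (⊤_ 𝒞) ⨯ Y) i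
      inv := Sigma.desc fun i => prod.snd ≫ Sigma.ι (fun _ : I => Y) i
      hom_inv_id := Sigma.hom_ext _ _ fun i => by simp [prod.lift_snd_assoc]
      inv_hom_id := Sigma.hom_ext _ _ fun i => by
        have h : (prod.snd : (⊤_ 𝒞) ⨯ Y ⟶ Y) ≫ prod.lift (terminal.from Y) (𝟙 Y) = 𝟙 _ := by
          ext; simp [prod.lift_snd]
        simp [reassoc_of% h] }
  have h : prod.lift (copowerIndex I Y) (copowerFold I Y) =
      e.hom ≫ Sigma.desc fun i : I => prod.map (Sigma.ι (fun _ : I => ⊤_ 𝒞) i) (𝟙 Y) := by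
    refine Sigma.hom_ext _ _ fun i => ?_
    ext <;> simp [e]
  rw [h]
  exact IsIso.comp_isIso' e.isIso_hom this

lemma copower_hom_ext
    (copower_preserved : ∀ (I : Type) (C X : 𝒞),
      IsIso ((Sigma.desc fun i : I =>
          prod.map (Sigma.ι (fun _ : I => C) i) (𝟙 X)) :
        (∐ fun _ : I => C ⨯ X) ⟶ (∐ fun _ : I => C) ⨯ X))
    {I : Type} {Y Z : 𝒞} {f g : Z ⟶ ∐ fun _ : I => Y}
    (h_index : f ≫ copowerIndex I Y = g ≫ copowerIndex I Y)
    (h_fold : f ≫ copowerFold I Y = g ≫ copowerFold I Y) : f = g := by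
  have := isIso_lift_copowerIndex_copowerFold copower_preserved I Y
  rw [← cancel_mono (prod.lift (copowerIndex I Y) (copowerFold I Y))]
  ext <;> simpa [prod.lift_fst, prod.lift_snd]

lemma exists_copower_lift
    (copower_preserved : ∀ (I : Type) (C X : 𝒞),
      IsIso ((Sigma.desc fun i : I =>
          prod.map (Sigma.ι (fun _ : I => C) i) (𝟙 X)) :
        (∐ fun _ : I => C ⨯ X) ⟶ (∐ fun _ : I => C) ⨯ X))
    {I : Type} {Y Z : 𝒞} (f : Z ⟶ ∐ fun _ : I => ⊤_ 𝒞) (m : Z ⟶ Y) :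
    ∃ h : Z ⟶ ∐ fun _ : I => Y, h ≫ copowerIndex I Y = f ∧ h ≫ copowerFold I Y = m := by
  have := isIso_lift_copowerIndex_copowerFold copower_preserved I Y
  have key := IsIso.inv_hom_id (prod.lift (copowerIndex I Y) (copowerFold I Y))
  have h_fst := key =≫ prod.fst
  have h_snd := key =≫ prod.snd
  simp only [Category.assoc, prod.lift_fst, prod.lift_snd, Category.id_comp] at h_fst h_snd
  refine ⟨prod.lift f m ≫ inv (prod.lift (copowerIndex I Y) (copowerFold I Y)), ?_, ?_⟩
  · rw [Category.assoc, h_fst, prod.lift_fst]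
  · rw [Category.assoc, h_snd, prod.lift_snd]

lemma copowerProd_hom_ext
    (copower_preserved : ∀ (I : Type) (C X : 𝒞),
      IsIso ((Sigma.desc fun i : I =>
          prod.map (Sigma.ι (fun _ : I => C) i) (𝟙 X)) :
        (∐ fun _ : I => C ⨯ X) ⟶ (∐ fun _ : I => C) ⨯ X))
    {I J : Type} {X Z : 𝒞} {f g : Z ⟶ ∐ fun _ : I × J => X}
    (h_left : f ≫ Sigma.desc (fun p : I × J => terminal.from X ≫ Sigma.ι (fun _ : I => ⊤_ 𝒞) p.1) =
      g ≫ Sigma.desc (fun p : I × J => terminal.from X ≫ Sigma.ι (fun _ : I => ⊤_ 𝒞) p.1))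
    (h_right : f ≫ Sigma.desc (fun p : I × J => Sigma.ι (fun _ : J => X) p.2) =
      g ≫ Sigma.desc (fun p : I × J => Sigma.ι (fun _ : J => X) p.2)) : f = g := by
  let curry : (∐ fun _ : I × J => X) ⟶ ∐ fun _ : I => ∐ fun _ : J => X :=
    Sigma.desc fun p => Sigma.ι (fun _ : J => X) p.2 ≫ Sigma.ι (fun _ : I => ∐ fun _ : J => X) p.1
  let uncurry : (∐ fun _ : I => ∐ fun _ : J => X) ⟶ ∐ fun _ : I × J => X :=
    Sigma.desc fun i => Sigma.desc fun j => Sigma.ι (fun _ : I × J => X) (i, j)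
  have h_inv : curry ≫ uncurry = 𝟙 _ := Sigma.hom_ext _ _ fun p => by simp [curry, uncurry]
  have h_index : curry ≫ copowerIndex I _ =
      Sigma.desc (fun p : I × J => terminal.from X ≫ Sigma.ι (fun _ : I => ⊤_ 𝒞) p.1) :=
    Sigma.hom_ext _ _ fun p => by
      simp only [curry, Sigma.ι_desc_assoc, Sigma.ι_desc, Category.assoc, ι_copowerIndex]
      rw [← Category.assoc]
      congr 1
      exact Subsingleton.elim _ _
  have h_fold : curry ≫ copowerFold I _ =
      Sigma.desc (fun p : I × J => Sigma.ι (fun _ : J => X) p.2) :=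
    Sigma.hom_ext _ _ fun p => by simp [curry]
  have h_curry : f ≫ curry = g ≫ curry :=
    copower_hom_ext copower_preserved (by simpa [h_index] using h_left)
      (by simpa [h_fold] using h_right)
  simpa [h_inv] using h_curry =≫ uncurry

lemma isHyperaffineDualOp_iff
    (copower_preserved : ∀ (I : Type) (C X : 𝒞),
      IsIso ((Sigma.desc fun i : I =>
          prod.map (Sigma.ι (fun _ : I => C) i) (𝟙 X)) :
        (∐ fun _ : I => C ⨯ X) ⟶ (∐ fun _ : I => C) ⨯ X))
    {X : 𝒞} {I : Type} (h : X ⟶ ∐ fun _ : I => X) :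
    IsHyperaffineDualOp 𝒞 h ↔ h ≫ copowerFold I X = 𝟙 X := by
  constructor
  · rintro ⟨h_affine, -⟩
    rw [desc_const_eq_copowerFold_comp] at h_affine
    simpa using h_affine =≫ copowerFold PUnit X
  · intro h_fold
    refine ⟨by rw [desc_const_eq_copowerFold_comp, reassoc_of% h_fold], ?_⟩
    apply copowerProd_hom_ext copower_preserved
    · simp only [Category.assoc]
      congr 1
      refine Sigma.hom_ext _ _ fun i => ?_
      have h_const : (Sigma.desc fun j : I => Sigma.ι (fun _ : I × I => X) (i, j)) ≫
          Sigma.desc (fun p : I × I => terminal.from X ≫ Sigma.ι (fun _ : I => ⊤_ 𝒞) p.1) =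
          copowerFold I X ≫ terminal.from X ≫ Sigma.ι (fun _ : I => ⊤_ 𝒞) i :=
        Sigma.hom_ext _ _ fun j => by simp
      simp [h_const]
    · have h_inner (i : I) : (Sigma.desc fun j : I => Sigma.ι (fun _ : I × I => X) (i, j)) ≫
          Sigma.desc (fun p : I × I => Sigma.ι (fun _ : I => X) p.2) = 𝟙 _ :=
        Sigma.hom_ext _ _ fun j => by simp
      have h_outer : (Sigma.desc fun i : I =>
            h ≫ Sigma.desc fun j : I => Sigma.ι (fun _ : I × I => X) (i, j)) ≫
          Sigma.desc (fun p : I × I => Sigma.ι (fun _ : I => X) p.2) = copowerFold I X ≫ h :=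
        Sigma.hom_ext _ _ fun i => by simp [h_inner]
      have h_diag : (Sigma.desc fun i : I => Sigma.ι (fun _ : I × I => X) (i, i)) ≫
          Sigma.desc (fun p : I × I => Sigma.ι (fun _ : I => X) p.2) = 𝟙 _ :=
        Sigma.hom_ext _ _ fun i => by simp
      rw [Category.assoc, Category.assoc, h_outer, h_diag, reassoc_of% h_fold, Category.comp_id]

lemma eq_comp_desc_unary_iff
    (copower_preserved : ∀ (I : Type) (C X : 𝒞),
      IsIso ((Sigma.desc fun i : I =>
          prod.map (Sigma.ι (fun _ : I => C) i) (𝟙 X)) :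
        (∐ fun _ : I => C ⨯ X) ⟶ (∐ fun _ : I => C) ⨯ X))
    {X : 𝒞} {I : Type} (t h : X ⟶ ∐ fun _ : I => X) (m : X ⟶ ∐ fun _ : PUnit => X)
    (h_fold : h ≫ copowerFold I X = 𝟙 X) :
    (t = h ≫ Sigma.desc (fun i : I =>
        m ≫ Sigma.desc (fun _ : PUnit => Sigma.ι (fun _ : I => X) i))) ↔
      h ≫ copowerIndex I X = t ≫ copowerIndex I X ∧
        m ≫ copowerFold PUnit X = t ≫ copowerFold I X := by
  have h_index : Sigma.desc (fun i : I =>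
      m ≫ Sigma.desc (fun _ : PUnit => Sigma.ι (fun _ : I => X) i)) ≫ copowerIndex I X =
        copowerIndex I X :=
    Sigma.hom_ext _ _ fun i => by
      simp only [desc_const_eq_copowerFold_comp, Sigma.ι_desc_assoc, Category.assoc, ι_copowerIndex]
      simp only [← Category.assoc]
      congr 1
      exact Subsingleton.elim _ _
  have h_comp : Sigma.desc (fun i : I =>
      m ≫ Sigma.desc (fun _ : PUnit => Sigma.ι (fun _ : I => X) i)) ≫ copowerFold I X =
        copowerFold I X ≫ m ≫ copowerFold PUnit X :=
    Sigma.hom_ext _ _ fun i => by simp [desc_const_eq_copowerFold_comp]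
  constructor
  · rintro rfl
    simp only [Category.assoc, h_index, h_comp, reassoc_of% h_fold, and_self]
  · rintro ⟨hi, hm⟩
    apply copower_hom_ext copower_preserved
    · rw [Category.assoc, h_index, hi]
    · rw [Category.assoc, h_comp, reassoc_of% h_fold, hm]

variable (𝒞)

/-- If `𝒞` has finite products and set-indexed copowers, and each `(−) × X`
preserves copowers, then for every `X ∈ 𝒞` the complete theory of dual
operations `𝕋_X` — with `T_X(I) = 𝒞(X, I·X)`, projections the coprojections,
and substitution `(t, u) ↦ t ≫ ⟨u_i⟩` — is hyperaffine–unary: every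
`t ∈ T_X(I)` decomposes uniquely as `t = h(λi. m)` with `h` hyperaffine and
`m ∈ T_X(1)`. -/
theorem dual_operations_hyperaffine_unary
    (copower_preserved : ∀ (I : Type) (C X : 𝒞),
      IsIso ((Sigma.desc fun i : I =>
          prod.map (Sigma.ι (fun _ : I => C) i) (𝟙 X)) :
        (∐ fun _ : I => C ⨯ X) ⟶ (∐ fun _ : I => C) ⨯ X))
    (X : 𝒞) (I : Type) (t : X ⟶ ∐ fun _ : I => X) :
    ∃! p : (X ⟶ ∐ fun _ : I => X) × (X ⟶ ∐ fun _ : PUnit => X),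
      IsHyperaffineDualOp 𝒞 p.1 ∧
      t = p.1 ≫ Sigma.desc (fun i : I =>
            p.2 ≫ Sigma.desc (fun _ : PUnit => Sigma.ι (fun _ : I => X) i)) := by
  obtain ⟨h, h_index, h_fold⟩ :=
    exists_copower_lift copower_preserved (t ≫ copowerIndex I X) (𝟙 X)
  refine ⟨(h, (t ≫ copowerFold I X) ≫ Sigma.ι (fun _ : PUnit => X) PUnit.unit), ⟨?_, ?_⟩, ?_⟩
  · exact (isHyperaffineDualOp_iff copower_preserved h).2 h_fold
  · exact (eq_comp_desc_unary_iff copower_preserved t h _ h_fold).2 ⟨h_index, by simp⟩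
  · rintro ⟨k, m⟩ ⟨hk, ht⟩
    rw [isHyperaffineDualOp_iff copower_preserved] at hk
    obtain ⟨hi, hm⟩ := (eq_comp_desc_unary_iff copower_preserved t k m hk).1 ht
    refine Prod.ext (copower_hom_ext copower_preserved (hi.trans h_index.symm)
      (hk.trans h_fold.symm)) ?_
    have h_unit : copowerFold PUnit X ≫ Sigma.ι (fun _ : PUnit => X) PUnit.unit = 𝟙 _ :=
      Sigma.hom_ext _ _ fun _ => by simp
    simpa [h_unit] using hm =≫ Sigma.ι (fun _ : PUnit => X) PUnit.unit

end
end
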